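/- arXiv:2411.01384 — 6 statements merged into one kernel-verified Lean document; each statement's English description precedes it below -/
import Mathlib

section
/- Let α be a linearly ordered type, l a list over α, K a natural number, and let B be the list consisting of the K smallest entries of l (i.e., the first K entries of l after sorting l in nondecreasing order, or all of l if l has fewer than K entries). For every x ∈ α, if the number of entries of l strictly less than x is at most K, then the number of entries of B strictly less than x equals the number of entries of l strictly less than x. -/
theorem List.countP_lt_take_of_pairwise_le {α : Type*} [LinearOrder α] {s : List α}
    (hs : s.Pairwise (· ≤ ·)) {K : ℕ} {x : α}
    (hK : s.countP (fun y => decide (y < x)) ≤ K) :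
    (s.take K).countP (fun y => decide (y < x)) = s.countP (fun y => decide (y < x)) := by
  induction s generalizing K with
  | nil => simp
  | cons a s ih =>
    obtain ⟨ha, hs⟩ := List.pairwise_cons.mp hs
    cases K with
    | zero => rw [List.take_zero, List.countP_nil, Nat.le_zero.mp hK]
    | succ K =>
      have hK' : s.countP (fun y => decide (y < x)) ≤ K := by
        by_cases hax : a < x
        · simpa [hax] using hK
        · have h0 : s.countP (fun y => decide (y < x)) = 0 :=
            List.countP_eq_zero.mpr fun y hy => by
              simpa using (not_lt.mp hax).trans (ha y hy)
          exact h0 ▸ K.zero_le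
      rw [List.take_succ_cons, List.countP_cons, List.countP_cons, ih hs hK']

/-- **Keeping the `K` smallest elements preserves small ranks.**
Let `B` consist of the `K` smallest entries of `l` (the first `K` entries of `l` after
sorting nondecreasingly, or all of `l` if it is shorter).  For every query `x`, if the
number of entries of `l` strictly less than `x` is at most `K`, then the number of
entries of `B` strictly less than `x` equals the number of entries of `l` strictly
less than `x`. -/
theorem take_smallest_preserves_low_ranks {α : Type*} [LinearOrder α]
    (l : List α) (K : ℕ) (B : List α)
    (hB : B = (List.insertionSort (· ≤ ·) l).take K) (x : α)
    (hx : l.countP (fun y => decide (y < x)) ≤ K) :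
    B.countP (fun y => decide (y < x)) = l.countP (fun y => decide (y < x)) := by
  have hperm := (List.perm_insertionSort (· ≤ ·) l).countP_eq (fun y => decide (y < x))
  rw [hB, ← hperm]
  exact List.countP_lt_take_of_pairwise_le (List.pairwise_insertionSort (· ≤ ·) l) (hperm.trans_le hx)
end

section
/- Let k be a positive real number, let m be a natural number, and let s_1, …, s_m be positive real numbers; set ℓ_t = ⌈s_t / k⌉ for each 1 ≤ t ≤ m. Define the progress measure z : {0,1,…,m} → ℝ recursively by z_0 = 0 and z_t = 2^{−ℓ_t} · (⌊2^{ℓ_t} · z_{t−1}⌋ + 1), i.e., z_t is the least integer multiple of 2^{−ℓ_t} strictly greater than z_{t−1}. Then for every 1 ≤ t ≤ m one has z_{t−1} < z_t ≤ z_{t−1} + 2^{−ℓ_t}, and for every 0 ≤ t ≤ m one has z_t ≤ Σ_{u=1}^{t} 2^{−s_u / k}. In particular, if Σ_{u=1}^{m} 2^{−s_u/k} < 1, then z_t < 1 for every t. -/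
open Finset

/-- The least multiple of `2 ^ (-n)` strictly above `x` exceeds `x` by at most `2 ^ (-n)`. -/
theorem lt_and_le_add_two_zpow_neg (n : ℤ) (x : ℝ) :
    x < (2 : ℝ) ^ (-n) * ((⌊(2 : ℝ) ^ n * x⌋ : ℝ) + 1) ∧
      (2 : ℝ) ^ (-n) * ((⌊(2 : ℝ) ^ n * x⌋ : ℝ) + 1) ≤ x + (2 : ℝ) ^ (-n) := by
  have hpos : (0 : ℝ) < 2 ^ (-n) := by positivity
  have hx : (2 : ℝ) ^ (-n) * (2 ^ n * x) = x := by
    rw [zpow_neg, inv_mul_cancel_left₀ (by positivity)]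
  constructor
  · calc x = (2 : ℝ) ^ (-n) * (2 ^ n * x) := hx.symm
      _ < _ := mul_lt_mul_of_pos_left (Int.lt_floor_add_one _) hpos
  · calc (2 : ℝ) ^ (-n) * ((⌊(2 : ℝ) ^ n * x⌋ : ℝ) + 1)
        ≤ (2 : ℝ) ^ (-n) * (2 ^ n * x + 1) := by
          gcongr
          exact Int.floor_le _
      _ = x + (2 : ℝ) ^ (-n) := by rw [mul_add, hx, mul_one]

theorem two_zpow_neg_ceil_le_rpow (x : ℝ) : (2 : ℝ) ^ (-⌈x⌉) ≤ (2 : ℝ) ^ (-x) := by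
  rw [← Real.rpow_intCast]
  apply Real.rpow_le_rpow_of_exponent_le one_le_two
  push_cast
  exact neg_le_neg (Int.le_ceil x)

/-- **The progress measure is bounded by the running sum.**
Let `k > 0`, `s 1, …, s m > 0`, and `ℓ t = ⌈s t / k⌉`.  The progress measure is defined
by `z 0 = 0` and `z t` being the least integer multiple of `2 ^ (−ℓ t)` strictly greater
than `z (t−1)`, i.e. `z t = 2^(−ℓ t) · (⌊2^(ℓ t) · z (t−1)⌋ + 1)`.  Then each step
increases `z` by at most `2^(−ℓ t)` (and by a positive amount), `z t` is bounded by the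
running sum `Σ_{u=1}^{t} 2^(−s u / k)`, and in particular if the total sum is `< 1`
then `z` always stays below `1`. -/
theorem progress_measure_le_running_sum
    (k : ℝ) (hk : 0 < k) (m : ℕ) (s : ℕ → ℝ)
    (hs : ∀ t, 1 ≤ t → t ≤ m → 0 < s t)
    (ℓ : ℕ → ℤ) (hℓ : ∀ t, ℓ t = ⌈s t / k⌉)
    (z : ℕ → ℝ) (hz0 : z 0 = 0)
    (hzrec : ∀ t, 1 ≤ t → t ≤ m →
      z t = (2 : ℝ) ^ (-(ℓ t)) * ((⌊(2 : ℝ) ^ (ℓ t) * z (t - 1)⌋ : ℝ) + 1)) :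
    (∀ t, 1 ≤ t → t ≤ m →
        z (t - 1) < z t ∧ z t ≤ z (t - 1) + (2 : ℝ) ^ (-(ℓ t))) ∧
    (∀ t, t ≤ m → z t ≤ ∑ u ∈ Finset.Icc 1 t, (2 : ℝ) ^ (-(s u / k))) ∧
    ((∑ u ∈ Finset.Icc 1 m, (2 : ℝ) ^ (-(s u / k)) < 1) →
      ∀ t, t ≤ m → z t < 1) := by
  have hstep : ∀ t, 1 ≤ t → t ≤ m →
      z (t - 1) < z t ∧ z t ≤ z (t - 1) + (2 : ℝ) ^ (-(ℓ t)) := by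
    intro t h1 hm
    rw [hzrec t h1 hm]
    exact lt_and_le_add_two_zpow_neg _ _
  have hsum : ∀ t, t ≤ m → z t ≤ ∑ u ∈ Finset.Icc 1 t, (2 : ℝ) ^ (-(s u / k)) := by
    intro t
    induction t with
    | zero => simp [hz0]
    | succ t ih =>
      intro hm
      rw [Finset.sum_Icc_succ_top (by omega)]
      have hle := (hstep (t + 1) (by omega) hm).2
      rw [Nat.add_sub_cancel, hℓ] at hle
      exact hle.trans (add_le_add (ih (by omega)) (two_zpow_neg_ceil_le_rpow _))
  refine ⟨hstep, hsum, fun hlt t hm => ((hsum t hm).trans ?_).trans_lt hlt⟩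
  exact Finset.sum_le_sum_of_subset_of_nonneg (Finset.Icc_subset_Icc_right hm)
    fun _ _ _ => by positivity
end

section
/- Consider a layered interval structure with levels 0,…,L+1 over the time horizon {0,…,T−1} that has the bounded-parents property, and let φ be its potential function. Then for every level 0 ≤ i ≤ L+1, the sum of the potentials of all level-i intervals satisfies Σ_{j < ℓ_i} φ_{i,j} ≤ 4^{L+1−i} · ℓ_{L+1}. In particular, the potential φ_{i,j} of every interval is at most 4^{L+1} · ℓ_{L+1}. -/
open Finset

/-- A layered interval structure with levels `0, …, L+1` over the time horizon
`{0, …, T−1}`: at each level `i ≤ L+1` there are `len i ≥ 1` intervals determined by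
strictly increasing breakpoints `0 = bp i 0 < bp i 1 < ⋯ < bp i (len i) = T`. -/
structure LayeredIntervalStructure (L T : ℕ) where
  len : ℕ → ℕ
  bp : ℕ → ℕ → ℕ
  len_pos : ∀ i, i ≤ L + 1 → 0 < len i
  bp_zero : ∀ i, i ≤ L + 1 → bp i 0 = 0
  bp_last : ∀ i, i ≤ L + 1 → bp i (len i) = T
  bp_mono : ∀ i, i ≤ L + 1 → ∀ j, j < len i → bp i j < bp i (j + 1)

/-- The `j`-th interval at level `i`: `I i j = {bp i j, …, bp i (j+1) − 1}`. -/
def LayeredIntervalStructure.interval {L T : ℕ} (S : LayeredIntervalStructure L T)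
    (i j : ℕ) : Finset ℕ :=
  Finset.Ico (S.bp i j) (S.bp i (j + 1))

/-- `φ` is the potential function of the structure: every bottom-level (level `L+1`)
interval has potential `1`, and the potential of an interval at level `i ≤ L` is the
sum of the potentials of all level-(`i+1`) intervals intersecting it. -/
def LayeredIntervalStructure.IsPotential {L T : ℕ} (S : LayeredIntervalStructure L T)
    (φ : ℕ → ℕ → ℕ) : Prop :=
  (∀ j, j < S.len (L + 1) → φ (L + 1) j = 1) ∧
  (∀ i, i ≤ L → ∀ j, j < S.len i → φ i j =
    ∑ m ∈ (Finset.range (S.len (i + 1))).filter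
        (fun m => (S.interval (i + 1) m ∩ S.interval i j).Nonempty),
      φ (i + 1) m)

/-- The bounded-parents property: each level-(`i+1`) interval intersects at most `4`
level-`i` intervals. -/
def LayeredIntervalStructure.BoundedParents {L T : ℕ}
    (S : LayeredIntervalStructure L T) : Prop :=
  ∀ i, i ≤ L → ∀ m, m < S.len (i + 1) →
    ((Finset.range (S.len i)).filter
        (fun j => (S.interval i j ∩ S.interval (i + 1) m).Nonempty)).card ≤ 4

namespace LayeredIntervalStructure

variable {L T : ℕ} {S : LayeredIntervalStructure L T} {φ : ℕ → ℕ → ℕ}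

/-- Passing from level `i + 1` to level `i` multiplies the total potential by at most `4`. -/
theorem IsPotential.sum_le_four_mul_sum_succ (hφ : S.IsPotential φ) (hbp : S.BoundedParents)
    {i : ℕ} (hi : i ≤ L) :
    ∑ j ∈ Finset.range (S.len i), φ i j ≤
      4 * ∑ m ∈ Finset.range (S.len (i + 1)), φ (i + 1) m := by
  rw [Finset.sum_congr rfl fun j hj => hφ.2 i hi j (Finset.mem_range.1 hj)]
  simp_rw [Finset.sum_filter]
  rw [Finset.sum_comm, Finset.mul_sum]
  refine Finset.sum_le_sum fun m hm => ?_
  rw [← Finset.sum_filter, Finset.sum_const, smul_eq_mul]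
  simp_rw [Finset.inter_comm (S.interval (i + 1) m)]
  exact Nat.mul_le_mul_right _ (hbp i hi m (Finset.mem_range.1 hm))

theorem IsPotential.sum_le (hφ : S.IsPotential φ) (hbp : S.BoundedParents)
    {i : ℕ} (hi : i ≤ L + 1) :
    ∑ j ∈ Finset.range (S.len i), φ i j ≤ 4 ^ (L + 1 - i) * S.len (L + 1) := by
  induction hi using Nat.decreasingInduction with
  | self =>
    rw [Finset.sum_congr rfl fun j hj => hφ.1 j (Finset.mem_range.1 hj)]
    simp
  | of_succ k hk ih =>
    refine (hφ.sum_le_four_mul_sum_succ hbp (Nat.le_of_lt_succ hk)).trans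
      ((Nat.mul_le_mul_left 4 ih).trans_eq ?_)
    rw [← mul_assoc, ← pow_succ', show L + 1 - (k + 1) + 1 = L + 1 - k by omega]

end LayeredIntervalStructure

/-- **Potentials are polynomially bounded.**  In a layered interval structure with the
bounded-parents property, the sum of the potentials of all level-`i` intervals is at
most `4^(L+1−i) · len (L+1)`; in particular each individual potential is at most
`4^(L+1) · len (L+1)`. -/
theorem potential_sum_le {L T : ℕ} (hT : 1 ≤ T)
    (S : LayeredIntervalStructure L T) (φ : ℕ → ℕ → ℕ)
    (hφ : S.IsPotential φ) (hbp : S.BoundedParents) :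
    (∀ i, i ≤ L + 1 →
      ∑ j ∈ Finset.range (S.len i), φ i j ≤ 4 ^ (L + 1 - i) * S.len (L + 1)) ∧
    (∀ i, i ≤ L + 1 → ∀ j, j < S.len i →
      φ i j ≤ 4 ^ (L + 1) * S.len (L + 1)) := by
  refine ⟨fun i hi => hφ.sum_le hbp hi, fun i hi j hj => ?_⟩
  calc φ i j ≤ ∑ j ∈ Finset.range (S.len i), φ i j :=
        Finset.single_le_sum (fun _ _ => Nat.zero_le _) (Finset.mem_range.2 hj)
    _ ≤ 4 ^ (L + 1 - i) * S.len (L + 1) := hφ.sum_le hbp hi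
    _ ≤ 4 ^ (L + 1) * S.len (L + 1) :=
        Nat.mul_le_mul_right _ (Nat.pow_le_pow_right (by norm_num) (Nat.sub_le _ _))
end

section
/- Consider a layered interval structure with levels 0,…,L+1 over the time horizon {0,…,T−1} with potential function φ, let ε be a real with 0 < ε ≤ 1, and define the space allocation s_{i,t} = ε^{-1}·(log₂(φ_{i,j_i(t)} / φ_{i+1,j_{i+1}(t)}) + 5·log₂(1/ε)) for 0 ≤ i ≤ L and t < T. Then: (i) every interval has potential at least 1; (ii) φ_{i,j_i(t)} ≥ φ_{i+1,j_{i+1}(t)} for all i and t, so every s_{i,t} ≥ 0; (iii) for every time t < T, Σ_{i=0}^{L} s_{i,t} = ε^{-1}·(log₂ φ_{0,j_0(t)} + 5·(L+1)·log₂(1/ε)); and (iv) if the structure moreover has the bounded-parents property, then Σ_{i=0}^{L} s_{i,t} ≤ ε^{-1}·(2·(L+1) + log₂(ℓ_{L+1}) + 5·(L+1)·log₂(1/ε)) for every t < T. -/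
open Finset

namespace LayeredIntervalStructure

variable {L T : ℕ} (S : LayeredIntervalStructure L T) {φ : ℕ → ℕ → ℕ}

theorem bp_le_horizon {i j : ℕ} (hi : i ≤ L + 1) (hj : j ≤ S.len i) : S.bp i j ≤ T := by
  induction hj using Nat.decreasingInduction with
  | self => exact (S.bp_last i hi).le
  | of_succ k hk ih => exact (S.bp_mono i hi k hk).le.trans ih

/-- Every time in the horizon lies in some interval of each level. -/
theorem exists_mem_interval {i t : ℕ} (hi : i ≤ L + 1) (ht : t < T) :
    ∃ j < S.len i, t ∈ S.interval i j := by
  have aux : ∀ n, t < S.bp i n → ∃ j < n, t ∈ S.interval i j := by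
    intro n
    induction n with
    | zero => intro h; rw [S.bp_zero i hi] at h; omega
    | succ n ih =>
      intro h
      by_cases hn : t < S.bp i n
      · obtain ⟨j, hj, hmem⟩ := ih hn
        exact ⟨j, hj.trans n.lt_succ_self, hmem⟩
      · exact ⟨n, n.lt_succ_self, Finset.mem_Ico.2 ⟨not_lt.1 hn, h⟩⟩
  exact aux _ (by rwa [S.bp_last i hi])

theorem bp_mem_interval {i j : ℕ} (hi : i ≤ L + 1) (hj : j < S.len i) :
    S.bp i j ∈ S.interval i j :=
  Finset.mem_Ico.2 ⟨le_rfl, S.bp_mono i hi j hj⟩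

variable {S}

/-- The potential of an interval is at least that of each child meeting it. -/
theorem IsPotential.le_of_mem (hφ : S.IsPotential φ) {i j m t : ℕ} (hi : i ≤ L)
    (hj : j < S.len i) (hm : m < S.len (i + 1)) (htj : t ∈ S.interval i j)
    (htm : t ∈ S.interval (i + 1) m) : φ (i + 1) m ≤ φ i j := by
  rw [hφ.2 i hi j hj]
  exact Finset.single_le_sum (f := φ (i + 1)) (fun _ _ => Nat.zero_le _)
    (Finset.mem_filter.2 ⟨Finset.mem_range.2 hm, t, Finset.mem_inter.2 ⟨htm, htj⟩⟩)

theorem IsPotential.one_le (hφ : S.IsPotential φ) {i j : ℕ} (hi : i ≤ L + 1)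
    (hj : j < S.len i) : 1 ≤ φ i j := by
  induction hi using Nat.decreasingInduction generalizing j with
  | self => exact (hφ.1 j hj).ge
  | of_succ k hk ih =>
    have hmem := S.bp_mem_interval hk.le hj
    have hlt : S.bp k j < T := (S.bp_mono k hk.le j hj).trans_le (S.bp_le_horizon hk.le hj)
    obtain ⟨m, hm, hmem'⟩ := S.exists_mem_interval (i := k + 1) hk hlt
    exact (ih hm).trans (hφ.le_of_mem (Nat.lt_succ_iff.1 hk) hj hm hmem hmem')

/-- Under bounded parents, the total potential grows by a factor at most `4` per level. -/
theorem IsPotential.sum_le_four_mul (hφ : S.IsPotential φ) (hS : S.BoundedParents) {i : ℕ}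
    (hi : i ≤ L) :
    ∑ j ∈ Finset.range (S.len i), φ i j ≤
      4 * ∑ m ∈ Finset.range (S.len (i + 1)), φ (i + 1) m := by
  rw [Finset.sum_congr rfl fun j hj => hφ.2 i hi j (Finset.mem_range.1 hj)]
  simp_rw [Finset.sum_filter]
  rw [Finset.sum_comm, Finset.mul_sum]
  refine Finset.sum_le_sum fun m hm => ?_
  rw [← Finset.sum_filter, Finset.sum_const, smul_eq_mul]
  refine Nat.mul_le_mul_right _ ?_
  simpa only [Finset.inter_comm] using hS i hi m (Finset.mem_range.1 hm)

theorem IsPotential.sum_le_pow (hφ : S.IsPotential φ) (hS : S.BoundedParents) {i : ℕ}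
    (hi : i ≤ L + 1) :
    ∑ j ∈ Finset.range (S.len i), φ i j ≤ 4 ^ (L + 1 - i) * S.len (L + 1) := by
  induction hi using Nat.decreasingInduction with
  | self =>
    rw [Finset.sum_congr rfl fun j hj => hφ.1 j (Finset.mem_range.1 hj)]
    simp
  | of_succ k hk ih =>
    refine (hφ.sum_le_four_mul hS (Nat.lt_succ_iff.1 hk)).trans ?_
    rw [show L + 1 - k = (L + 1 - (k + 1)) + 1 by omega, pow_succ', mul_assoc]
    exact Nat.mul_le_mul_left 4 ih

theorem IsPotential.logb_le (hφ : S.IsPotential φ) (hS : S.BoundedParents) {j : ℕ}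
    (hj : j < S.len 0) :
    Real.logb 2 (φ 0 j) ≤ 2 * (L + 1) + Real.logb 2 (S.len (L + 1)) := by
  have hle : φ 0 j ≤ 4 ^ (L + 1) * S.len (L + 1) :=
    (Finset.single_le_sum (f := φ 0) (fun _ _ => Nat.zero_le _) (Finset.mem_range.2 hj)).trans
      (hφ.sum_le_pow hS (Nat.zero_le _))
  have hpos : (0 : ℝ) < φ 0 j := by exact_mod_cast hφ.one_le (Nat.zero_le _) hj
  have hlen : (S.len (L + 1) : ℝ) ≠ 0 := by exact_mod_cast (S.len_pos (L + 1) le_rfl).ne'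
  have hlog : Real.logb 2 ((4 : ℝ) ^ (L + 1)) = 2 * (L + 1) := by
    rw [show (4 : ℝ) = 2 ^ 2 by norm_num, ← pow_mul, Real.logb_pow,
      Real.logb_self_eq_one one_lt_two]
    push_cast
    ring
  rw [← hlog, ← Real.logb_mul (by positivity) hlen]
  exact Real.logb_le_logb_of_le one_lt_two hpos (by exact_mod_cast hle)

end LayeredIntervalStructure

/-- **The offline space allocation is nonnegative and telescopes.**
With `jdx i t` the unique index of the level-`i` interval containing time `t`, and the
space allocation `s i t = ε⁻¹·(log₂(φ i (jdx i t) / φ (i+1) (jdx (i+1) t)) + 5·log₂(1/ε))`: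
(i) every potential is at least `1`; (ii) potentials decrease along child intervals,
so every `s i t` is nonnegative; (iii) at every time `t` the total space over levels
`0, …, L` telescopes to `ε⁻¹·(log₂ (φ 0 (jdx 0 t)) + 5·(L+1)·log₂(1/ε))`; and
(iv) under the bounded-parents property this total is at most
`ε⁻¹·(2·(L+1) + log₂(len (L+1)) + 5·(L+1)·log₂(1/ε))`. -/
theorem offline_space_allocation_telescopes {L T : ℕ} (hT : 1 ≤ T)
    (S : LayeredIntervalStructure L T) (φ : ℕ → ℕ → ℕ) (hφ : S.IsPotential φ)
    (ε : ℝ) (hε0 : 0 < ε) (hε1 : ε ≤ 1)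
    (jdx : ℕ → ℕ → ℕ)
    (hjdx : ∀ i, i ≤ L + 1 → ∀ t, t < T →
      jdx i t < S.len i ∧ t ∈ S.interval i (jdx i t))
    (s : ℕ → ℕ → ℝ)
    (hs : ∀ i t, s i t = ε⁻¹ *
      (Real.logb 2 ((φ i (jdx i t) : ℝ) / (φ (i + 1) (jdx (i + 1) t) : ℝ)) +
        5 * Real.logb 2 (1 / ε))) :
    (∀ i, i ≤ L + 1 → ∀ j, j < S.len i → 1 ≤ φ i j) ∧
    (∀ i, i ≤ L → ∀ t, t < T →
      φ (i + 1) (jdx (i + 1) t) ≤ φ i (jdx i t) ∧ 0 ≤ s i t) ∧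
    (∀ t, t < T → ∑ i ∈ Finset.range (L + 1), s i t =
      ε⁻¹ * (Real.logb 2 (φ 0 (jdx 0 t)) +
        5 * (L + 1) * Real.logb 2 (1 / ε))) ∧
    (S.BoundedParents → ∀ t, t < T → ∑ i ∈ Finset.range (L + 1), s i t ≤
      ε⁻¹ * (2 * (L + 1) + Real.logb 2 (S.len (L + 1)) +
        5 * (L + 1) * Real.logb 2 (1 / ε))) := by
  have hle : ∀ i, i ≤ L → ∀ t, t < T → φ (i + 1) (jdx (i + 1) t) ≤ φ i (jdx i t) := by
    intro i hi t ht
    obtain ⟨hj, htj⟩ := hjdx i (by omega) t ht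
    obtain ⟨hm, htm⟩ := hjdx (i + 1) (by omega) t ht
    exact hφ.le_of_mem hi hj hm htj htm
  have hpos : ∀ i, i ≤ L + 1 → ∀ t, t < T → (0 : ℝ) < φ i (jdx i t) := by
    intro i hi t ht
    exact_mod_cast hφ.one_le hi (hjdx i hi t ht).1
  have htotal : ∀ t, t < T → ∑ i ∈ Finset.range (L + 1), s i t =
      ε⁻¹ * (Real.logb 2 (φ 0 (jdx 0 t)) + 5 * (L + 1) * Real.logb 2 (1 / ε)) := by
    intro t ht
    have hlast : φ (L + 1) (jdx (L + 1) t) = 1 := hφ.1 _ (hjdx _ le_rfl t ht).1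
    have hsum : ∑ i ∈ Finset.range (L + 1),
        Real.logb 2 ((φ i (jdx i t) : ℝ) / (φ (i + 1) (jdx (i + 1) t) : ℝ)) =
        Real.logb 2 (φ 0 (jdx 0 t)) := by
      rw [Finset.sum_congr rfl fun i hi => Real.logb_div
        (hpos i (Finset.mem_range.1 hi).le t ht).ne'
        (hpos (i + 1) (Finset.mem_range.1 hi) t ht).ne',
        Finset.sum_range_sub' fun i => Real.logb 2 (φ i (jdx i t)), hlast]
      simp
    simp_rw [hs]
    rw [← Finset.mul_sum, Finset.sum_add_distrib, hsum, Finset.sum_const, Finset.card_range,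
      nsmul_eq_mul]
    push_cast
    ring
  refine ⟨fun i hi j hj => hφ.one_le hi hj, fun i hi t ht => ⟨hle i hi t ht, ?_⟩, htotal,
    fun hS t ht => ?_⟩
  · have hratio : 0 ≤ Real.logb 2 ((φ i (jdx i t) : ℝ) / (φ (i + 1) (jdx (i + 1) t) : ℝ)) :=
      Real.logb_nonneg one_lt_two
        ((one_le_div (hpos (i + 1) (by omega) t ht)).2 (by exact_mod_cast hle i hi t ht))
    have heps : 0 ≤ Real.logb 2 (1 / ε) :=
      Real.logb_nonneg one_lt_two ((one_le_div hε0).2 hε1)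
    rw [hs]
    positivity
  · rw [htotal t ht]
    have hlog := hφ.logb_le hS (hjdx 0 (Nat.zero_le _) t ht).1
    gcongr
end

section
/- For every real ε with 0 < ε ≤ 1 and every natural number n ≥ 1, there exists a finite set S ⊆ {0, 1, …, n} with 0 ∈ S and n ∈ S such that: (i) any two consecutive elements a < b of S satisfy b − a ≤ max(1, ε·a) as real numbers; and (ii) the cardinality of S is at most 8·ε^{-1}·(log₂(ε·n + 2) + 2) + 8. -/
/-- A step from rank `m` up to rank `n` that is long compared with `ε * n + 2` raises the potential
`8 * ε⁻¹ * log₂ (ε * x + 2)` by at least one. -/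
lemma potential_add_one_le {ε : ℝ} (hε : 0 < ε) {m n : ℝ} (hm : 0 ≤ m) (hmn : m ≤ n)
    (h : ε * n + 2 ≤ 8 * (n - m)) :
    8 * ε⁻¹ * Real.logb 2 (ε * m + 2) + 1 ≤ 8 * ε⁻¹ * Real.logb 2 (ε * n + 2) := by
  have hB : 0 < ε * m + 2 := by positivity
  have hA : 0 < ε * n + 2 := by nlinarith
  have hlog : ε * (n - m) / (ε * n + 2) ≤ Real.log (ε * n + 2) - Real.log (ε * m + 2) := by
    rw [← Real.log_div hA.ne' hB.ne']
    refine le_trans (le_of_eq ?_) (Real.one_sub_inv_le_log_of_pos (div_pos hA hB))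
    field_simp
    ring
  have hpos : 0 ≤ ε * (n - m) / (ε * n + 2) :=
    div_nonneg (mul_nonneg hε.le (sub_nonneg.2 hmn)) hA.le
  have hlog2 : Real.log 2 ≤ 1 := by linarith [Real.log_two_lt_d9]
  have hlogb : ε * (n - m) / (ε * n + 2) ≤
      Real.logb 2 (ε * n + 2) - Real.logb 2 (ε * m + 2) := by
    rw [Real.logb, Real.logb, ← sub_div, le_div_iff₀ (Real.log_pos one_lt_two)]
    exact (mul_le_of_le_one_right hpos hlog2).trans hlog
  have hone : 1 ≤ 8 * ε⁻¹ * (ε * (n - m) / (ε * n + 2)) := by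
    have : 8 * ε⁻¹ * (ε * (n - m) / (ε * n + 2)) = 8 * (n - m) / (ε * n + 2) := by
      field_simp
    rw [this, le_div_iff₀ hA]
    linarith
  have := mul_le_mul_of_nonneg_left hlogb (by positivity : 0 ≤ 8 * ε⁻¹)
  linarith

/-- Every positive rank `n` has an admissible predecessor `m` at distance at least
`(ε * n + 2) / 8`. -/
lemma exists_admissible_predecessor {ε : ℝ} (hε0 : 0 < ε) (hε1 : ε ≤ 1) {n : ℕ} (hn : 1 ≤ n) :
    ∃ m < n, (n : ℝ) - m ≤ max 1 (ε * m) ∧ ε * n + 2 ≤ 8 * ((n : ℝ) - m) := by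
  rcases le_or_gt (ε * n) 6 with h | h
  · refine ⟨n - 1, by omega, ?_, ?_⟩ <;> push_cast [hn]
    · simp
    · linarith
  · have hlow := Nat.le_ceil ((n : ℝ) / (1 + ε))
    have hupp := Nat.ceil_lt_add_one (a := (n : ℝ) / (1 + ε)) (by positivity)
    set m := ⌈(n : ℝ) / (1 + ε)⌉₊
    rw [div_le_iff₀ (by positivity)] at hlow
    have hdiv : (n : ℝ) / (1 + ε) ≤ n - ε * n / 2 := by
      rw [div_le_iff₀ (by positivity)]
      nlinarith [mul_nonneg (mul_nonneg hε0.le (Nat.cast_nonneg (α := ℝ) n)) (sub_nonneg.2 hε1)]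
    refine ⟨m, ?_, le_max_of_le_right (by linarith), by linarith⟩
    exact_mod_cast (by linarith : (m : ℝ) < n)

/-- Consecutive elements of `insert n S` are consecutive in `S`, or are `max S` and `n`, when `n`
exceeds every element of `S`. -/
lemma consecutive_insert {S : Finset ℕ} {m n : ℕ} {P : ℕ → ℕ → Prop} (hS : ∀ a ∈ S, a ≤ m)
    (hm : m ∈ S) (hmn : m < n) (hP : P m n)
    (h : ∀ a ∈ S, ∀ b ∈ S, a < b → (∀ c ∈ S, ¬(a < c ∧ c < b)) → P a b) :
    ∀ a ∈ insert n S, ∀ b ∈ insert n S, a < b →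
      (∀ c ∈ insert n S, ¬(a < c ∧ c < b)) → P a b := by
  intro a ha b hb hab hc
  have hcS : ∀ c ∈ S, ¬(a < c ∧ c < b) := fun c hcS => hc c (Finset.mem_insert_of_mem hcS)
  rcases Finset.mem_insert.1 hb with rfl | hbS
  · rcases Finset.mem_insert.1 ha with rfl | ha
    · exact absurd hab (lt_irrefl _)
    · obtain rfl : a = m := by
        by_contra hne
        exact hcS m hm ⟨lt_of_le_of_ne (hS a ha) hne, hmn⟩
      exact hP
  · rcases Finset.mem_insert.1 ha with rfl | haS
    · have := hS b hbS
      omega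
    · exact h a haS b hbS hab hcS

lemma exists_summary_card_le_potential {ε : ℝ} (hε0 : 0 < ε) (hε1 : ε ≤ 1) (n : ℕ) :
    ∃ S : Finset ℕ, S ⊆ Finset.range (n + 1) ∧ 0 ∈ S ∧ n ∈ S ∧
      (∀ a ∈ S, ∀ b ∈ S, a < b → (∀ c ∈ S, ¬(a < c ∧ c < b)) →
        (b : ℝ) - (a : ℝ) ≤ max 1 (ε * a)) ∧
      (S.card : ℝ) ≤ 8 * ε⁻¹ * Real.logb 2 (ε * n + 2) + 1 := by
  induction n using Nat.strong_induction_on with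
  | _ n ih =>
    rcases Nat.eq_zero_or_pos n with rfl | hn
    · refine ⟨{0}, by simp, by simp, by simp, by simp, ?_⟩
      simp [hε0.le]
    · obtain ⟨m, hmn, hgap, hlong⟩ := exists_admissible_predecessor hε0 hε1 hn
      obtain ⟨S, hS, h0, hm, hcons, hcard⟩ := ih m hmn
      have hle : ∀ a ∈ S, a ≤ m := fun a ha => by
        have := Finset.mem_range.1 (hS ha)
        omega
      refine ⟨insert n S, ?_, Finset.mem_insert_of_mem h0, Finset.mem_insert_self _ _,
        consecutive_insert hle hm hmn hgap hcons, ?_⟩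
      · intro a ha
        rcases Finset.mem_insert.1 ha with rfl | ha
        · simp
        · have := hle a ha
          exact Finset.mem_range.2 (by omega)
      · have hins : ((insert n S).card : ℝ) ≤ S.card + 1 := by
          exact_mod_cast Finset.card_insert_le n S
        have := potential_add_one_le hε0 (Nat.cast_nonneg m)
          (by exact_mod_cast hmn.le : (m : ℝ) ≤ n) hlong
        linarith

/-- **Offline relative-error quantile summaries of near-optimal size exist.**
For every `0 < ε ≤ 1` and `n ≥ 1` there is a set `S ⊆ {0, …, n}` of stored ranks
containing `0` and `n`, whose consecutive elements `a < b` satisfy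
`b − a ≤ max 1 (ε·a)`, of cardinality at most `8·ε⁻¹·(log₂(ε·n + 2) + 2) + 8`. -/
theorem offline_relative_error_summary_exists
    (ε : ℝ) (hε0 : 0 < ε) (hε1 : ε ≤ 1) (n : ℕ) (hn : 1 ≤ n) :
    ∃ S : Finset ℕ, S ⊆ Finset.range (n + 1) ∧ 0 ∈ S ∧ n ∈ S ∧
      (∀ a ∈ S, ∀ b ∈ S, a < b → (∀ c ∈ S, ¬(a < c ∧ c < b)) →
        (b : ℝ) - (a : ℝ) ≤ max 1 (ε * a)) ∧
      (S.card : ℝ) ≤ 8 * ε⁻¹ * (Real.logb 2 (ε * n + 2) + 2) + 8 := by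
  obtain ⟨S, hS, h0, hnS, hcons, hcard⟩ := exists_summary_card_le_potential hε0 hε1 n
  refine ⟨S, hS, h0, hnS, hcons, ?_⟩
  have := inv_pos.2 hε0
  linarith
end

section
/- Let ε be a real with 0 < ε ≤ 1/4 and let n be a natural number with ε·n ≥ 2. Then every finite set S ⊆ {0, 1, …, n} with 0 ∈ S and n ∈ S, all of whose consecutive elements a < b satisfy b − a ≤ max(1, ε·a) as real numbers, has cardinality |S| ≥ (1/(4ε))·⌊log₂(ε·n)⌋. -/
/-- If consecutive elements `p < a` of `S ∋ 0` satisfy `a - p ≤ max 1 (ε * p)`, then at least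
`log (ε * a) / ε` elements of `S` lie strictly below each `a ∈ S`. -/
theorem log_mul_le_mul_card_filter_lt {ε : ℝ} (hε : 0 < ε) {S : Finset ℕ} (h0 : 0 ∈ S)
    (hgap : ∀ a ∈ S, ∀ b ∈ S, a < b → (∀ c ∈ S, ¬(a < c ∧ c < b)) →
      (b : ℝ) - (a : ℝ) ≤ max 1 (ε * a)) (a : ℕ) (ha : a ∈ S) :
    Real.log (ε * a) ≤ ε * ((S.filter (· < a)).card : ℝ) := by
  induction a using Nat.strong_induction_on with
  | _ a ih =>
  rcases Nat.eq_zero_or_pos a with rfl | hpos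
  · simp
  obtain ⟨p, hp, hmax⟩ := (S.filter (· < a)).exists_max_image id
    ⟨0, Finset.mem_filter.2 ⟨h0, hpos⟩⟩
  obtain ⟨hpS, hpa⟩ := Finset.mem_filter.1 hp
  have hstep := hgap p hpS a ha hpa fun c hc ⟨hpc, hca⟩ =>
    absurd (hmax c (Finset.mem_filter.2 ⟨hc, hca⟩)) (not_le.2 hpc)
  have ha0 : (0 : ℝ) < a := by exact_mod_cast hpos
  have hcard : (S.filter (· < p)).card + 1 ≤ (S.filter (· < a)).card := by
    refine Finset.card_lt_card (Finset.ssubset_iff_of_subset ?_ |>.2 ⟨p, hp, by simp⟩)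
    exact Finset.monotone_filter_right S fun c _ hc => lt_trans hc hpa
  have hcard' : ((S.filter (· < p)).card : ℝ) + 1 ≤ (S.filter (· < a)).card := by
    exact_mod_cast hcard
  rcases le_total (ε * p) 1 with hsmall | hlarge
  · rw [max_eq_left hsmall] at hstep
    have hlog := Real.log_le_sub_one_of_pos (mul_pos hε ha0)
    have hcount : (0 : ℝ) ≤ (S.filter (· < p)).card := Nat.cast_nonneg _
    nlinarith
  · rw [max_eq_right hlarge] at hstep
    have hεp : 0 < ε * p := by linarith
    have hε1 : 0 < 1 + ε := by linarith
    calc Real.log (ε * a) ≤ Real.log (ε * p * (1 + ε)) :=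
          Real.log_le_log (mul_pos hε ha0) (by nlinarith)
      _ = Real.log (ε * p) + Real.log (1 + ε) := Real.log_mul hεp.ne' hε1.ne'
      _ ≤ ε * ((S.filter (· < p)).card : ℝ) + ε := by
          have := Real.log_le_sub_one_of_pos hε1
          linarith [ih p hpa hpS]
      _ ≤ ε * ((S.filter (· < a)).card : ℝ) := by nlinarith

/-- **Offline lower bound for relative-error quantile summaries.**
Let `0 < ε ≤ 1/4` and `ε·n ≥ 2`.  Every set `S ⊆ {0, …, n}` of stored ranks containing
`0` and `n` whose consecutive elements `a < b` satisfy `b − a ≤ max 1 (ε·a)` has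
cardinality at least `(1/(4ε))·⌊log₂(ε·n)⌋`. -/
theorem offline_relative_error_summary_lower_bound
    (ε : ℝ) (hε0 : 0 < ε) (hε1 : ε ≤ 1 / 4) (n : ℕ) (hεn : 2 ≤ ε * n)
    (S : Finset ℕ) (hsub : S ⊆ Finset.range (n + 1)) (h0 : 0 ∈ S) (hnS : n ∈ S)
    (hgap : ∀ a ∈ S, ∀ b ∈ S, a < b → (∀ c ∈ S, ¬(a < c ∧ c < b)) →
      (b : ℝ) - (a : ℝ) ≤ max 1 (ε * a)) :
    (1 / (4 * ε)) * (⌊Real.logb 2 (ε * n)⌋ : ℝ) ≤ (S.card : ℝ) := by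
  have hlog : Real.log (ε * n) ≤ ε * S.card := by
    refine (log_mul_le_mul_card_filter_lt hε0 h0 hgap n hnS).trans ?_
    have : ((S.filter (· < n)).card : ℝ) ≤ S.card := by
      exact_mod_cast Finset.card_filter_le _ _
    gcongr
  have hlog2 := Real.log_two_gt_d9
  have hcount : (0 : ℝ) ≤ S.card := Nat.cast_nonneg _
  have hlogb : Real.logb 2 (ε * n) ≤ 4 * ε * S.card := by
    rw [Real.logb, div_le_iff₀ (by linarith)]
    nlinarith [mul_nonneg hε0.le hcount]
  rw [one_div, inv_mul_le_iff₀ (by positivity)]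
  exact (Int.floor_le _).trans hlogb
end
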